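/- Let K be a basic closed semi-algebraic set defined by polynomials g_1,…,g_m, and let Q(g) = {Σ_{j=0}^m σ_j g_j : σ_j ∈ Σ[x]} (with g_0 = 1) be the associated quadratic module. Then the closure of Q(g) in the weighted ℓ1-norm ‖f‖_w = Σ_α (2⌈|α|/2⌉)! |f_α| equals the cone Psd(K) of polynomials nonnegative on K. -/

import Mathlib

open MvPolynomial

/-- The weight `w_α = (2⌈|α|/2⌉)!`. -/
def wt {n : ℕ} (α : Fin n →₀ ℕ) : ℕ :=
  (2 * (((α.sum fun _ e => e) + 1) / 2)).factorial

/-- The weighted ℓ₁-norm `‖f‖_w = ∑_α w_α |f_α|`. -/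
def wnorm {n : ℕ} (f : MvPolynomial (Fin n) ℝ) : ℝ :=
  ∑ α ∈ f.support, (wt α : ℝ) * |f.coeff α|

/-- A polynomial is a sum of squares. -/
def IsSOS {n : ℕ} (σ : MvPolynomial (Fin n) ℝ) : Prop :=
  ∃ (k : ℕ) (p : Fin k → MvPolynomial (Fin n) ℝ), σ = ∑ i, (p i) ^ 2

/-- Membership in the quadratic module `Q(g) = {σ₀ + ∑ⱼ σⱼ gⱼ : σⱼ ∈ Σ[x]}`. -/
def memQM {n m : ℕ} (g : Fin m → MvPolynomial (Fin n) ℝ)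
    (f : MvPolynomial (Fin n) ℝ) : Prop :=
  ∃ (σ₀ : MvPolynomial (Fin n) ℝ) (σ : Fin m → MvPolynomial (Fin n) ℝ),
    IsSOS σ₀ ∧ (∀ j, IsSOS (σ j)) ∧ f = σ₀ + ∑ j, σ j * g j

universe u

theorem exists_commCStarAlgebra_of_commute {A : Type u} [CStarAlgebra A] {σ : Type*} (a : σ → A)
    (hsa : ∀ i, IsSelfAdjoint (a i)) (hcomm : ∀ i j, a i * a j = a j * a i) :
    ∃ (B : Type u) (_ : CommCStarAlgebra B) (φ : B →⋆ₐ[ℂ] A), Function.Injective φ ∧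
      (∀ b, spectrum ℂ (φ b) = spectrum ℂ b) ∧ ∀ i, ∃ b, φ b = a i := by
  let S₀ := StarAlgebra.adjoin ℂ (Set.range a)
  have : IsMulCommutative S₀ := StarAlgebra.isMulCommutative_adjoin ℂ
    (by rintro _ ⟨i, rfl⟩ _ ⟨j, rfl⟩; exact hcomm i j)
    (by rintro _ ⟨i, rfl⟩ _ ⟨j, rfl⟩; rw [(hsa j).star_eq]; exact hcomm i j)
  let S : StarSubalgebra ℂ A := S₀.topologicalClosure
  have hS : IsClosed (S : Set A) := S₀.isClosed_topologicalClosure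
  have hmul : ∀ x y : S, x * y = y * x :=
    (S₀.commRingTopologicalClosure (fun x y => mul_comm' x y)).mul_comm
  let _ : CommCStarAlgebra S := { StarSubalgebra.cstarAlgebra S with mul_comm := hmul }
  refine ⟨S, inferInstance, S.subtype, Subtype.val_injective, fun b => S.spectrum_eq.symm,
    fun i => ⟨⟨a i, ?_⟩, rfl⟩⟩
  exact S₀.le_topologicalClosure (StarAlgebra.subset_adjoin ℂ _ ⟨i, rfl⟩)

theorem sum_antidiagonal_neg_pow_mul_pow (z : ℂ) (N : ℕ) :
    ∑ x ∈ Finset.HasAntidiagonal.antidiagonal N,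
      ((-z) ^ x.1 / (x.1.factorial : ℂ)) * (z ^ x.2 / (x.2.factorial : ℂ)) =
        if N = 0 then 1 else 0 := by
  have h := (Commute.all (-z) z).add_pow' N
  have hN : (N.factorial : ℂ) ≠ 0 := by exact_mod_cast N.factorial_ne_zero
  have : (N.factorial : ℂ) * ∑ x ∈ Finset.HasAntidiagonal.antidiagonal N,
      ((-z) ^ x.1 / (x.1.factorial : ℂ)) * (z ^ x.2 / (x.2.factorial : ℂ)) = (-z + z) ^ N := by
    rw [h, Finset.mul_sum]
    refine Finset.sum_congr rfl fun x hx => ?_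
    rw [Finset.HasAntidiagonal.mem_antidiagonal] at hx
    have h1 : (x.1.factorial : ℂ) ≠ 0 := by exact_mod_cast x.1.factorial_ne_zero
    have h2 : (x.2.factorial : ℂ) ≠ 0 := by exact_mod_cast x.2.factorial_ne_zero
    have h3 : ((N.choose x.1 : ℕ) : ℂ) * x.1.factorial * x.2.factorial = N.factorial := by
      subst hx
      rw [Nat.choose_symm_add]
      exact_mod_cast Nat.add_choose_mul_factorial_mul_factorial x.1 x.2
    rw [nsmul_eq_mul, ← h3]
    field_simp
  rw [neg_add_cancel] at this
  split_ifs with h0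
  · subst h0; simp
  · rw [zero_pow h0] at this
    exact (mul_eq_zero.mp this).resolve_left hN

theorem inner_pow_symm {V E : Type*} [AddCommGroup V] [Module ℂ V] [NormedAddCommGroup E]
    [InnerProductSpace ℂ E] (ι : V →ₗ[ℂ] E) (X : V →ₗ[ℂ] V)
    (hX : ∀ p q, inner ℂ (ι (X p)) (ι q) = inner ℂ (ι p) (ι (X q))) (k : ℕ) (p q : V) :
    inner ℂ (ι ((X ^ k) p)) (ι q) = inner ℂ (ι p) (ι ((X ^ k) q)) := by
  induction k generalizing p q with
  | zero => simp
  | succ k ih => rw [pow_succ, Module.End.mul_apply, ih, hX, ← Module.End.mul_apply,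
      ← pow_succ', pow_succ]

theorem summable_norm_exp_series {V E : Type*} [AddCommGroup V] [Module ℂ V]
    [NormedAddCommGroup E] [InnerProductSpace ℂ E] (ι : V →ₗ[ℂ] E) (X : V →ₗ[ℂ] V)
    (hb : ∀ p, ∃ C : ℝ, ∀ k : ℕ, ‖ι ((X ^ k) p)‖ ≤ C * 4 ^ k * k.factorial)
    {z : ℂ} (hz : ‖z‖ = 1 / 8) (p : V) :
    Summable fun k : ℕ => ‖(z ^ k / (k.factorial : ℂ)) • ι ((X ^ k) p)‖ := by
  obtain ⟨C, hC⟩ := hb p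
  refine Summable.of_nonneg_of_le (fun _ => norm_nonneg _) (fun k => ?_)
    ((summable_geometric_two).mul_left C)
  have hk : (0 : ℝ) < k.factorial := by exact_mod_cast k.factorial_pos
  rw [norm_smul, norm_div, norm_pow, hz, Complex.norm_natCast]
  calc (1 / 8 : ℝ) ^ k / k.factorial * ‖ι ((X ^ k) p)‖
      ≤ (1 / 8 : ℝ) ^ k / k.factorial * (C * 4 ^ k * k.factorial) := by gcongr; exact hC k
    _ = C * ((1 / 8 : ℝ) ^ k * 4 ^ k) := by field_simp
    _ = C * (1 / 2) ^ k := by rw [← mul_pow]; norm_num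

theorem norm_exp_series_eq {V E : Type*} [AddCommGroup V] [Module ℂ V]
    [NormedAddCommGroup E] [InnerProductSpace ℂ E] [CompleteSpace E]
    (ι : V →ₗ[ℂ] E) (X : V →ₗ[ℂ] V)
    (hX : ∀ p q, inner ℂ (ι (X p)) (ι q) = inner ℂ (ι p) (ι (X q)))
    (hb : ∀ p, ∃ C : ℝ, ∀ k : ℕ, ‖ι ((X ^ k) p)‖ ≤ C * 4 ^ k * k.factorial)
    {z : ℂ} (hz : ‖z‖ = 1 / 8) (hzc : (starRingEnd ℂ) z = -z) (p : V) :
    ‖∑' k : ℕ, (z ^ k / (k.factorial : ℂ)) • ι ((X ^ k) p)‖ = ‖ι p‖ := by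
  set a : ℕ → E := fun k => (z ^ k / (k.factorial : ℂ)) • ι ((X ^ k) p) with ha
  have hs : Summable fun k => ‖a k‖ := summable_norm_exp_series ι X hb hz p
  have hsa : Summable a := hs.of_norm
  have hsum : Summable fun x : ℕ × ℕ => inner ℂ (a x.1) (a x.2) := by
    refine Summable.of_norm_bounded (g := fun x : ℕ × ℕ => ‖a x.1‖ * ‖a x.2‖)
      (hs.mul_of_nonneg hs (fun _ => norm_nonneg _) (fun _ => norm_nonneg _)) ?_
    exact fun x => norm_inner_le_norm _ _
  have h1 : ∑' x : ℕ × ℕ, inner ℂ (a x.1) (a x.2) = inner ℂ (∑' k, a k) (∑' k, a k) := by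
    rw [hsum.tsum_prod]
    have h2 : ∀ j, ∑' k, inner ℂ (a j) (a k) = inner ℂ (a j) (∑' k, a k) := fun j =>
      ((innerSL ℂ (a j)).map_tsum hsa).symm
    simp_rw [h2]
    have h3 := (innerSL ℂ (∑' k, a k)).map_tsum hsa
    simp only [innerSL_apply_apply] at h3
    rw [← inner_conj_symm, h3, Complex.conj_tsum]
    simp only [inner_conj_symm]
  have h4 : ∑' x : ℕ × ℕ, inner ℂ (a x.1) (a x.2) = inner ℂ (ι p) (ι p) := by
    have hsum' := Finset.HasAntidiagonal.sigmaAntidiagonalEquivProd.summable_iff.mpr hsum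
    simp only [Function.comp_def] at hsum'
    rw [← Finset.HasAntidiagonal.sigmaAntidiagonalEquivProd.tsum_eq,
      hsum'.tsum_sigma' (fun _ => (hasSum_fintype _).summable)]
    have h5 : ∀ N : ℕ, ∑' x : Finset.HasAntidiagonal.antidiagonal N,
        inner ℂ (a (Finset.HasAntidiagonal.sigmaAntidiagonalEquivProd ⟨N, x⟩).1)
          (a (Finset.HasAntidiagonal.sigmaAntidiagonalEquivProd ⟨N, x⟩).2) =
        if N = 0 then inner ℂ (ι p) (ι p) else 0 := by
      intro N
      simp only [Finset.HasAntidiagonal.sigmaAntidiagonalEquivProd_apply]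
      rw [Finset.tsum_subtype (Finset.HasAntidiagonal.antidiagonal N)
        (fun x : ℕ × ℕ => inner ℂ (a x.1) (a x.2))]
      have h6 : ∀ x ∈ Finset.HasAntidiagonal.antidiagonal N, inner ℂ (a x.1) (a x.2) =
          (((-z) ^ x.1 / (x.1.factorial : ℂ)) * (z ^ x.2 / (x.2.factorial : ℂ))) *
            inner ℂ (ι p) (ι ((X ^ N) p)) := by
        intro x hx
        rw [Finset.HasAntidiagonal.mem_antidiagonal] at hx
        simp only [ha, inner_smul_left, inner_smul_right]
        rw [inner_pow_symm ι X hX, ← Module.End.mul_apply, ← pow_add, hx]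
        simp only [map_div₀, map_pow, hzc, map_natCast]
        ring
      rw [Finset.sum_congr rfl h6, ← Finset.sum_mul, sum_antidiagonal_neg_pow_mul_pow]
      split_ifs with h0
      · subst h0; simp
      · simp
    rw [tsum_congr h5, tsum_ite_eq]
  rw [h1, inner_self_eq_norm_sq_to_K, inner_self_eq_norm_sq_to_K] at h4
  have h7 : ‖∑' k, a k‖ ^ 2 = ‖ι p‖ ^ 2 := by exact_mod_cast h4
  exact (pow_left_inj₀ (norm_nonneg _) (norm_nonneg _) two_ne_zero).mp h7

theorem denseRange_sub_smul {V E : Type*} [AddCommGroup V] [Module ℂ V]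
    [NormedAddCommGroup E] [InnerProductSpace ℂ E] [CompleteSpace E]
    (ι : V →ₗ[ℂ] E) (X : V →ₗ[ℂ] V) (hι : DenseRange ι)
    (hX : ∀ p q, inner ℂ (ι (X p)) (ι q) = inner ℂ (ι p) (ι (X q)))
    (hb : ∀ p, ∃ C : ℝ, ∀ k : ℕ, ‖ι ((X ^ k) p)‖ ≤ C * 4 ^ k * k.factorial)
    {c : ℂ} (hc : c = Complex.I ∨ c = -Complex.I) : DenseRange fun p => ι (X p - c • p) := by
  obtain ⟨z, hz, hzc, hzexp⟩ : ∃ z : ℂ, ‖z‖ = 1 / 8 ∧ (starRingEnd ℂ) z = -z ∧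
      z * c = ((1 / 8 : ℝ) : ℂ) := by
    rcases hc with rfl | rfl
    · refine ⟨-(Complex.I / 8), by simp, by simp [neg_div, Complex.conj_ofNat], ?_⟩
      push_cast; linear_combination (-1 / 8) * Complex.I_mul_I
    · refine ⟨Complex.I / 8, by simp, by simp [neg_div, Complex.conj_ofNat], ?_⟩
      push_cast; linear_combination (-1 / 8) * Complex.I_mul_I
  let T : V →ₗ[ℂ] E := ι ∘ₗ (X - c • LinearMap.id)
  have hT : (fun p => ι (X p - c • p)) = T := by ext p; simp [T]
  rw [hT]
  change Dense (Set.range T)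
  rw [← LinearMap.coe_range, Submodule.dense_iff_topologicalClosure_eq_top,
    Submodule.topologicalClosure_eq_top_iff, Submodule.eq_bot_iff]
  intro h hh
  have h1 : ∀ p, inner ℂ h (ι (X p)) = c * inner ℂ h (ι p) := by
    intro p
    have := (Submodule.mem_orthogonal' _ _).mp hh (T p) ⟨p, rfl⟩
    simp only [T, LinearMap.comp_apply, LinearMap.sub_apply, LinearMap.smul_apply,
      LinearMap.id_apply, map_sub, map_smul, inner_sub_right, inner_smul_right] at this
    linear_combination this
  have h2 : ∀ (k : ℕ) p, inner ℂ h (ι ((X ^ k) p)) = c ^ k * inner ℂ h (ι p) := by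
    intro k p
    induction k with
    | zero => simp
    | succ k ih => rw [pow_succ', Module.End.mul_apply, h1, ih]; ring
  have h3 : ∀ p, Real.exp (1 / 8) * ‖inner ℂ h (ι p)‖ ≤ ‖h‖ * ‖ι p‖ := by
    intro p
    have hsa := (summable_norm_exp_series ι X hb hz p).of_norm
    have h4 : inner ℂ h (∑' k : ℕ, (z ^ k / (k.factorial : ℂ)) • ι ((X ^ k) p)) =
        Complex.exp (z * c) * inner ℂ h (ι p) := by
      have h5 := (innerSL ℂ h).map_tsum hsa
      simp only [innerSL_apply_apply, inner_smul_right, h2] at h5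
      rw [h5, Complex.exp_eq_exp_ℂ, NormedSpace.exp_eq_tsum_div, ← tsum_mul_right]
      exact tsum_congr fun k => by rw [mul_pow]; ring
    have h6 := norm_inner_le_norm (𝕜 := ℂ) h
      (∑' k : ℕ, (z ^ k / (k.factorial : ℂ)) • ι ((X ^ k) p))
    rw [h4, norm_exp_series_eq ι X hX hb hz hzc, norm_mul, hzexp, Complex.norm_exp_ofReal] at h6
    exact h6
  have h7 : Real.exp (1 / 8) * ‖inner ℂ h h‖ ≤ ‖h‖ * ‖h‖ :=
    hι.induction_on (p := fun x => Real.exp (1 / 8) * ‖inner ℂ h x‖ ≤ ‖h‖ * ‖x‖) h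
      (isClosed_le (by fun_prop) (by fun_prop)) h3
  have h8 : ‖inner ℂ h h‖ = ‖h‖ * ‖h‖ := by
    rw [inner_self_eq_norm_sq_to_K]; simp [sq]
  rw [h8] at h7
  have h9 : (1 : ℝ) < Real.exp (1 / 8) := Real.one_lt_exp_iff.mpr (by norm_num)
  by_contra hne
  have : 0 < ‖h‖ * ‖h‖ := by have := norm_pos_iff.mpr hne; positivity
  nlinarith

theorem nonneg_iff_forall_characterSpace {A : Type u} [CStarAlgebra A] [PartialOrder A]
    [StarOrderedRing A] {B : Type u} [CommCStarAlgebra B] (φ : B →⋆ₐ[ℂ] A)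
    (hφ : ∀ b, spectrum ℂ (φ b) = spectrum ℂ b) {b : B} (hb : IsSelfAdjoint b) :
    0 ≤ φ b ↔ ∀ χ : WeakDual.characterSpace ℂ B, 0 ≤ (χ b).re := by
  rw [StarOrderedRing.nonneg_iff_spectrum_nonneg (R := ℝ) _ (hb.map φ)]
  have key : ∀ r : ℝ, r ∈ spectrum ℝ (φ b) ↔ ∃ χ : WeakDual.characterSpace ℂ B, χ b = r := by
    intro r
    rw [← spectrum.algebraMap_mem_iff ℂ, hφ, WeakDual.CharacterSpace.mem_spectrum_iff_exists]
    rfl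
  simp only [key]
  constructor
  · intro h χ
    refine h _ ⟨χ, ?_⟩
    have := (hb.map χ).star_eq
    exact (Complex.conj_eq_iff_re.mp this).symm
  · rintro h r ⟨χ, hχ⟩
    simpa [hχ] using h χ

/-- The operator `T` acts on the image of `ι` as multiplication by the fraction `q / d`. -/
def ActsAsFraction {n : ℕ} {E : Type u} [NormedAddCommGroup E] [InnerProductSpace ℂ E]
    (ι : MvPolynomial (Fin n) ℂ →ₗ[ℂ] E) (T : E →L[ℂ] E) (d q : MvPolynomial (Fin n) ℂ) : Prop :=
  ∀ p, T (ι (d * p)) = ι (q * p)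

/-- A linear map on complex polynomials with dense range in a Hilbert space, such that
multiplication by a variable is symmetric with analytic vectors. -/
structure IsAnalyticRep {n : ℕ} {E : Type u} [NormedAddCommGroup E] [InnerProductSpace ℂ E]
    (ι : MvPolynomial (Fin n) ℂ →ₗ[ℂ] E) : Prop where
  dense : DenseRange ι
  symm : ∀ (f : MvPolynomial (Fin n) ℝ) p q,
    inner ℂ (ι (map Complex.ofRealHom f * p)) (ι q) =
      inner ℂ (ι p) (ι (map Complex.ofRealHom f * q))
  bound : ∀ (j : Fin n) p, ∃ C : ℝ, ∀ k : ℕ, ‖ι (X j ^ k * p)‖ ≤ C * 4 ^ k * k.factorial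

section Rep

variable {n : ℕ} {E : Type u} [NormedAddCommGroup E] [InnerProductSpace ℂ E]
  {ι : MvPolynomial (Fin n) ℂ →ₗ[ℂ] E}

namespace ActsAsFraction

theorem one : ActsAsFraction ι 1 1 1 := fun p => by simp

theorem mul {T T' : E →L[ℂ] E} {d d' q q' : MvPolynomial (Fin n) ℂ} (h : ActsAsFraction ι T d q)
    (h' : ActsAsFraction ι T' d' q') : ActsAsFraction ι (T * T') (d * d') (q * q') := fun p => by
  rw [mul_apply_eq_comp, show d * d' * p = d' * (d * p) by ring, h',
    show q' * (d * p) = d * (q' * p) by ring, h, mul_assoc]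

theorem pow {T : E →L[ℂ] E} {d q : MvPolynomial (Fin n) ℂ} (h : ActsAsFraction ι T d q) (k : ℕ) :
    ActsAsFraction ι (T ^ k) (d ^ k) (q ^ k) := by
  induction k with
  | zero => simpa using one
  | succ k ih => simpa only [pow_succ] using ih.mul h

theorem add {T T' : E →L[ℂ] E} {d q q' : MvPolynomial (Fin n) ℂ} (h : ActsAsFraction ι T d q)
    (h' : ActsAsFraction ι T' d q') : ActsAsFraction ι (T + T') d (q + q') := fun p => by
  rw [add_apply, h, h', add_mul, map_add]

theorem mul_den {T : E →L[ℂ] E} {d q : MvPolynomial (Fin n) ℂ} (h : ActsAsFraction ι T d q)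
    (r : MvPolynomial (Fin n) ℂ) : ActsAsFraction ι T (d * r) (q * r) := fun p => by
  rw [mul_assoc, h, mul_assoc]

theorem map_prod {B : Type u} [CommCStarAlgebra B] [CompleteSpace E] (φ : B →⋆ₐ[ℂ] (E →L[ℂ] E))
    {J : Type*} (S : Finset J) {b : J → B} {d q : J → MvPolynomial (Fin n) ℂ}
    (h : ∀ i ∈ S, ActsAsFraction ι (φ (b i)) (d i) (q i)) :
    ActsAsFraction ι (φ (∏ i ∈ S, b i)) (∏ i ∈ S, d i) (∏ i ∈ S, q i) := by
  classical
  induction S using Finset.induction_on with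
  | empty => simpa using one
  | insert i S hi ih =>
    rw [Finset.prod_insert hi, Finset.prod_insert hi, Finset.prod_insert hi, map_mul]
    exact (h i (Finset.mem_insert_self i S)).mul
      (ih fun k hk => h k (Finset.mem_insert_of_mem hk))

theorem sum_smul {J : Type*} (S : Finset J) (c : J → ℂ) {T : J → E →L[ℂ] E}
    {d : MvPolynomial (Fin n) ℂ} {q : J → MvPolynomial (Fin n) ℂ}
    (h : ∀ i ∈ S, ActsAsFraction ι (T i) d (q i)) :
    ActsAsFraction ι (∑ i ∈ S, c i • T i) d (∑ i ∈ S, c i • q i) := fun p => by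
  rw [sum_apply, Finset.sum_mul, map_sum]
  refine Finset.sum_congr rfl fun i hi => ?_
  rw [smul_apply, h i hi, smul_mul_assoc, map_smul]

theorem unique {T T' : E →L[ℂ] E} {d q : MvPolynomial (Fin n) ℂ} (h : ActsAsFraction ι T d q)
    (h' : ActsAsFraction ι T' d q) (hd : DenseRange fun p => ι (d * p)) : T = T' := by
  ext x
  exact hd.induction_on (p := fun x => T x = T' x) x (isClosed_eq (by fun_prop) (by fun_prop))
    fun p => by rw [h, h']

end ActsAsFraction

namespace IsAnalyticRep

theorem symm_X (hι : IsAnalyticRep ι) (j : Fin n) (p q : MvPolynomial (Fin n) ℂ) :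
    inner ℂ (ι (X j * p)) (ι q) = inner ℂ (ι p) (ι (X j * q)) := by
  simpa using hι.symm (X j) p q

theorem dense_mul_X_sub_C [CompleteSpace E] (hι : IsAnalyticRep ι) (j : Fin n) {c : ℂ}
    (hc : c = Complex.I ∨ c = -Complex.I) {s : MvPolynomial (Fin n) ℂ}
    (hs : DenseRange fun p => ι (s * p)) : DenseRange fun p => ι (s * (X j - C c) * p) := by
  have hpow : ∀ (k : ℕ) (p : MvPolynomial (Fin n) ℂ),
      (LinearMap.mulLeft ℂ (X j) ^ k) p = X j ^ k * p := by
    intro k p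
    rw [LinearMap.pow_mulLeft, LinearMap.mulLeft_apply]
  have h := denseRange_sub_smul (ι ∘ₗ LinearMap.mulLeft ℂ s) (LinearMap.mulLeft ℂ (X j)) hs
    (fun p q => by
      simp only [LinearMap.comp_apply, LinearMap.mulLeft_apply]
      rw [mul_left_comm, hι.symm_X, mul_left_comm])
    (fun p => by
      obtain ⟨C, hC⟩ := hι.bound j (s * p)
      refine ⟨C, fun k => ?_⟩
      rw [hpow, LinearMap.comp_apply, LinearMap.mulLeft_apply, mul_left_comm]
      exact hC k) hc
  convert h using 2 with p
  simp only [LinearMap.comp_apply, LinearMap.mulLeft_apply, MvPolynomial.smul_eq_C_mul]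
  ring_nf

theorem dense_mul_one_add_sq [CompleteSpace E] (hι : IsAnalyticRep ι) (j : Fin n)
    {s : MvPolynomial (Fin n) ℂ} (hs : DenseRange fun p => ι (s * p)) :
    DenseRange fun p => ι (s * (1 + X j ^ 2) * p) := by
  have h := hι.dense_mul_X_sub_C j (Or.inr rfl) (hι.dense_mul_X_sub_C j (Or.inl rfl) hs)
  have hCI : (C Complex.I : MvPolynomial (Fin n) ℂ) * C Complex.I = -1 := by
    rw [← C_mul, Complex.I_mul_I]; simp
  have : s * (X j - C Complex.I) * (X j - C (-Complex.I)) = s * (1 + X j ^ 2) := by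
    rw [C_neg]; linear_combination (-s) * hCI
  rwa [this] at h

theorem dense_mul_pow [CompleteSpace E] (hι : IsAnalyticRep ι) (j : Fin n) (k : ℕ)
    {s : MvPolynomial (Fin n) ℂ} (hs : DenseRange fun p => ι (s * p)) :
    DenseRange fun p => ι (s * (1 + X j ^ 2) ^ k * p) := by
  induction k with
  | zero => simpa using hs
  | succ k ih => simpa only [pow_succ, mul_assoc] using hι.dense_mul_one_add_sq j ih

theorem dense_prod [CompleteSpace E] (hι : IsAnalyticRep ι) (k : Fin n → ℕ) (S : Finset (Fin n)) :
    DenseRange fun p => ι ((∏ j ∈ S, (1 + X j ^ 2) ^ k j) * p) := by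
  induction S using Finset.induction_on with
  | empty => simpa using hι.dense
  | insert i S hi ih =>
    simpa only [Finset.prod_insert hi, mul_comm, mul_left_comm, mul_assoc] using
      hι.dense_mul_pow i (k i) ih

theorem dense_one_add_sq [CompleteSpace E] (hι : IsAnalyticRep ι) (j : Fin n) :
    DenseRange fun p => ι ((1 + X j ^ 2) * p) := by
  have := hι.dense_mul_one_add_sq j (s := 1) (by simpa using hι.dense)
  simpa only [one_mul] using this

theorem norm_sq_one_add_sq (hι : IsAnalyticRep ι) (j : Fin n) (p : MvPolynomial (Fin n) ℂ) :
    ‖ι ((1 + X j ^ 2) * p)‖ ^ 2 = ‖ι p‖ ^ 2 + 2 * ‖ι (X j * p)‖ ^ 2 + ‖ι (X j ^ 2 * p)‖ ^ 2 := by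
  rw [add_mul, one_mul, map_add, norm_add_sq (𝕜 := ℂ), pow_two (X j), mul_assoc, ← hι.symm_X,
    inner_self_eq_norm_sq]

theorem exists_acts [CompleteSpace E] (hι : IsAnalyticRep ι) (j : Fin n)
    {a : MvPolynomial (Fin n) ℂ} (ha : ∀ p, ‖ι (a * p)‖ ≤ ‖ι ((1 + X j ^ 2) * p)‖) :
    ∃ T : E →L[ℂ] E, ActsAsFraction ι T (1 + X j ^ 2) a := by
  refine ⟨(ι ∘ₗ LinearMap.mulLeft ℂ a).extendOfNorm (ι ∘ₗ LinearMap.mulLeft ℂ (1 + X j ^ 2)),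
    fun p => ?_⟩
  exact LinearMap.extendOfNorm_eq (f := ι ∘ₗ LinearMap.mulLeft ℂ a)
    (e := ι ∘ₗ LinearMap.mulLeft ℂ (1 + X j ^ 2)) (hι.dense_one_add_sq j)
    ⟨1, fun x => by simpa using ha x⟩ p

theorem isSelfAdjoint [CompleteSpace E] (hι : IsAnalyticRep ι) {T : E →L[ℂ] E}
    {d q : MvPolynomial (Fin n) ℝ}
    (hT : ActsAsFraction ι T (map Complex.ofRealHom d) (map Complex.ofRealHom q))
    (hd : DenseRange fun p => ι (map Complex.ofRealHom d * p)) : IsSelfAdjoint T := by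
  rw [ContinuousLinearMap.isSelfAdjoint_iff_isSymmetric]
  intro x y
  refine hd.induction_on₂ (p := fun x y => inner ℂ (T x) y = inner ℂ x (T y)) ?_ ?_ x y
  · exact isClosed_eq (by fun_prop) (by fun_prop)
  · intro p p'
    rw [hT, hT, hι.symm, hι.symm, mul_left_comm]

end IsAnalyticRep

end Rep

/-- For a polynomial `f` whose exponents are at most `N`, the bounded function
`f / ∏ i, (1 + x i ^ 2) ^ (2 * N)` expressed through `u i = x i / (1 + x i ^ 2)` and
`v i = 1 / (1 + x i ^ 2)`. -/
noncomputable def boundedTransform {n : ℕ} {B : Type*} [CommRing B] [Algebra ℂ B] (u v : Fin n → B)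
    (N : ℕ) (f : MvPolynomial (Fin n) ℝ) : B :=
  (∏ i, v i ^ N) * ∑ α ∈ f.support, ((f.coeff α : ℝ) : ℂ) • ∏ i, (u i ^ α i * v i ^ (N - α i))

theorem isSelfAdjoint_boundedTransform {n : ℕ} {B : Type*} [CommCStarAlgebra B] {u v : Fin n → B}
    (hu : ∀ i, IsSelfAdjoint (u i)) (hv : ∀ i, IsSelfAdjoint (v i)) (N : ℕ)
    (f : MvPolynomial (Fin n) ℝ) : IsSelfAdjoint (boundedTransform u v N f) := by
  have h1 : ∀ i, star (u i) = u i := hu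
  have h2 : ∀ i, star (v i) = v i := hv
  simp [isSelfAdjoint_iff, boundedTransform, star_prod, star_sum, h1, h2]

theorem re_map_boundedTransform {n : ℕ} {B : Type*} [CommCStarAlgebra B] {u v : Fin n → B}
    (χ : WeakDual.characterSpace ℂ B) {a b : Fin n → ℝ} (ha : ∀ i, χ (u i) = a i)
    (hb : ∀ i, χ (v i) = b i) (N : ℕ) (f : MvPolynomial (Fin n) ℝ) :
    (χ (boundedTransform u v N f)).re =
      (∏ i, b i ^ N) * ∑ α ∈ f.support, f.coeff α * ∏ i, (a i ^ α i * b i ^ (N - α i)) := by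
  have : χ (boundedTransform u v N f) = (((∏ i, b i ^ N) *
      ∑ α ∈ f.support, f.coeff α * ∏ i, (a i ^ α i * b i ^ (N - α i)) : ℝ) : ℂ) := by
    simp only [boundedTransform, map_mul, map_prod, map_sum, map_smul, map_pow, ha, hb, smul_eq_mul]
    push_cast
    rfl
  rw [this, Complex.ofReal_re]

theorem boundedTransform_real_eq {n : ℕ} {a b : Fin n → ℝ} (hb : ∀ i, b i ≠ 0) {N : ℕ}
    {f : MvPolynomial (Fin n) ℝ} (hN : ∀ α ∈ f.support, ∀ i, α i ≤ N) :
    (∏ i, b i ^ N) * ∑ α ∈ f.support, f.coeff α * ∏ i, (a i ^ α i * b i ^ (N - α i)) =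
      (∏ i, b i ^ N) ^ 2 * eval (fun i => a i / b i) f := by
  rw [sq, mul_assoc]
  congr 1
  rw [eval_eq', Finset.mul_sum]
  refine Finset.sum_congr rfl fun α hα => ?_
  rw [mul_left_comm, ← Finset.prod_mul_distrib]
  congr 1
  refine Finset.prod_congr rfl fun i _ => ?_
  have := hb i
  rw [div_pow, ← Nat.sub_add_cancel (hN α hα i), pow_add, Nat.add_sub_cancel]
  field_simp

theorem IsAnalyticRep.inner_boundedTransform {n : ℕ} {E : Type u} [NormedAddCommGroup E]
    [InnerProductSpace ℂ E] [CompleteSpace E] {ι : MvPolynomial (Fin n) ℂ →ₗ[ℂ] E}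
    {B : Type u} [CommCStarAlgebra B] (φ : B →⋆ₐ[ℂ] (E →L[ℂ] E)) {u v : Fin n → B}
    (hv : ∀ i, IsSelfAdjoint (v i)) (hu' : ∀ i, ActsAsFraction ι (φ (u i)) (1 + X i ^ 2) (X i))
    (hv' : ∀ i, ActsAsFraction ι (φ (v i)) (1 + X i ^ 2) 1) {N : ℕ}
    {f : MvPolynomial (Fin n) ℝ} (hN : ∀ α ∈ f.support, ∀ i, α i ≤ N)
    (p : MvPolynomial (Fin n) ℂ) :
    inner ℂ (ι ((∏ i, (1 + X i ^ 2) ^ N) * p))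
        (φ (boundedTransform u v N f) (ι ((∏ i, (1 + X i ^ 2) ^ N) * p))) =
      inner ℂ (ι p) (ι (map Complex.ofRealHom f * p)) := by
  have h1 : ActsAsFraction ι (φ (∏ i, v i ^ N)) (∏ i, (1 + X i ^ 2) ^ N) 1 := by
    have := ActsAsFraction.map_prod (ι := ι) φ Finset.univ
      (b := fun i => v i ^ N) (d := fun i => (1 + X i ^ 2) ^ N) (q := fun _ => 1 ^ N)
      fun i _ => by rw [map_pow]; exact (hv' i).pow N
    simpa using this
  have h2 : ActsAsFraction ι
      (φ (∑ α ∈ f.support, ((f.coeff α : ℝ) : ℂ) • ∏ i, (u i ^ α i * v i ^ (N - α i))))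
      (∏ i, (1 + X i ^ 2) ^ N) (map Complex.ofRealHom f) := by
    have h3 : ∀ α ∈ f.support, ActsAsFraction ι (φ (∏ i, (u i ^ α i * v i ^ (N - α i))))
        (∏ i, (1 + X i ^ 2) ^ N) (∏ i, X i ^ α i) := by
      intro α hα
      refine ActsAsFraction.map_prod φ Finset.univ fun i _ => ?_
      have := ((hu' i).pow (α i)).mul ((hv' i).pow (N - α i))
      rwa [← pow_add, Nat.add_sub_cancel' (hN α hα i), one_pow, mul_one, ← map_pow, ← map_pow,
        ← map_mul] at this
    have h4 := ActsAsFraction.sum_smul f.support (fun α => ((f.coeff α : ℝ) : ℂ)) h3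
    have h5 : ∑ α ∈ f.support, ((f.coeff α : ℝ) : ℂ) • ∏ i, X i ^ α i =
        map Complex.ofRealHom f := by
      conv_rhs => rw [f.as_sum, map_sum]
      refine Finset.sum_congr rfl fun α _ => ?_
      rw [map_monomial, monomial_eq, Finsupp.prod_fintype _ _ (fun _ => pow_zero _),
        smul_eq_C_mul]
      rfl
    rw [h5] at h4
    simpa only [map_sum, map_smul] using h4
  have h6 : IsSelfAdjoint (φ (∏ i, v i ^ N)) := by
    refine IsSelfAdjoint.map ?_ φ
    have h2 : ∀ i, star (v i) = v i := hv
    simp [isSelfAdjoint_iff, star_prod, h2]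
  rw [boundedTransform, map_mul φ, mul_apply_eq_comp, h2]
  refine ((ContinuousLinearMap.isSelfAdjoint_iff_isSymmetric.mp h6) _ _).symm.trans ?_
  change inner ℂ (φ (∏ i, v i ^ N) _) _ = _
  rw [h1, one_mul]

theorem IsAnalyticRep.inner_mul_nonneg {n m : ℕ} {E : Type u} [NormedAddCommGroup E]
    [InnerProductSpace ℂ E] [CompleteSpace E] {ι : MvPolynomial (Fin n) ℂ →ₗ[ℂ] E}
    (hι : IsAnalyticRep ι) (g : Fin m → MvPolynomial (Fin n) ℝ)
    (hg : ∀ j p, 0 ≤ (inner ℂ (ι p) (ι (map Complex.ofRealHom (g j) * p))).re)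
    {f : MvPolynomial (Fin n) ℝ} (hf : ∀ x, (∀ j, 0 ≤ eval x (g j)) → 0 ≤ eval x f)
    (p : MvPolynomial (Fin n) ℂ) : 0 ≤ (inner ℂ (ι p) (ι (map Complex.ofRealHom f * p))).re := by
  choose U hU using fun i => hι.exists_acts i (a := X i) fun p => by
    refine le_of_sq_le_sq ?_ (norm_nonneg _)
    rw [hι.norm_sq_one_add_sq]; nlinarith [sq_nonneg ‖ι p‖, sq_nonneg ‖ι (X i ^ 2 * p)‖,
      sq_nonneg ‖ι (X i * p)‖]
  choose V hV using fun i => hι.exists_acts i (a := 1) fun p => by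
    refine le_of_sq_le_sq ?_ (norm_nonneg _)
    rw [hι.norm_sq_one_add_sq, one_mul]
    nlinarith [sq_nonneg ‖ι (X i ^ 2 * p)‖, sq_nonneg ‖ι (X i * p)‖]
  have hUsa : ∀ i, IsSelfAdjoint (U i) := fun i =>
    hι.isSelfAdjoint (d := 1 + X i ^ 2) (q := X i) (by simpa using hU i)
      (by simpa using hι.dense_one_add_sq i)
  have hVsa : ∀ i, IsSelfAdjoint (V i) := fun i =>
    hι.isSelfAdjoint (d := 1 + X i ^ 2) (q := 1) (by simpa using hV i)
      (by simpa using hι.dense_one_add_sq i)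
  have hdd : ∀ i j : Fin n, DenseRange fun p => ι ((1 + X i ^ 2) * (1 + X j ^ 2) * p) :=
    fun i j => hι.dense_mul_one_add_sq j (hι.dense_one_add_sq i)
  have hcomm : ∀ {i j : Fin n} {T T' : E →L[ℂ] E} {q q' : MvPolynomial (Fin n) ℂ},
      ActsAsFraction ι T (1 + X i ^ 2) q → ActsAsFraction ι T' (1 + X j ^ 2) q' →
        T * T' = T' * T := by
    intro i j T T' q q' h h'
    refine (h.mul h').unique ?_ (hdd i j)
    rw [mul_comm (1 + X i ^ 2), mul_comm q]
    exact h'.mul h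
  obtain ⟨B, _, φ, hφi, hφs, hφa⟩ := exists_commCStarAlgebra_of_commute (Sum.elim U V)
    (by rintro (i | i); exacts [hUsa i, hVsa i])
    (by
      rintro (i | i) (j | j)
      exacts [hcomm (hU i) (hU j), hcomm (hU i) (hV j), hcomm (hV i) (hU j), hcomm (hV i) (hV j)])
  choose w hw using hφa
  set u : Fin n → B := fun i => w (Sum.inl i)
  set v : Fin n → B := fun i => w (Sum.inr i)
  have hu : ∀ i, φ (u i) = U i := fun i => hw (Sum.inl i)
  have hv : ∀ i, φ (v i) = V i := fun i => hw (Sum.inr i)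
  have husa : ∀ i, IsSelfAdjoint (u i) := fun i => hφi <| by
    rw [map_star, hu, (hUsa i).star_eq]
  have hvsa : ∀ i, IsSelfAdjoint (v i) := fun i => hφi <| by
    rw [map_star, hv, (hVsa i).star_eq]
  have hrel : ∀ i, u i * u i + v i * v i = v i := by
    intro i
    apply hφi
    rw [map_add, map_mul, map_mul, hu, hv]
    refine (((hU i).mul (hU i)).add ((hV i).mul (hV i))).unique ?_ (hdd i i)
    have := (hV i).mul_den (1 + X i ^ 2)
    rw [one_mul] at this
    rwa [show X i * X i + 1 * 1 = (1 + X i ^ 2 : MvPolynomial (Fin n) ℂ) by ring]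
  have hinner : ∀ {N : ℕ} {h : MvPolynomial (Fin n) ℝ}, (∀ α ∈ h.support, ∀ i, α i ≤ N) → ∀ p,
      inner ℂ (ι ((∏ i, (1 + X i ^ 2) ^ N) * p))
        (φ (boundedTransform u v N h) (ι ((∏ i, (1 + X i ^ 2) ^ N) * p))) =
      inner ℂ (ι p) (ι (map Complex.ofRealHom h * p)) := fun hN p =>
    IsAnalyticRep.inner_boundedTransform φ hvsa (fun i => hu i ▸ hU i) (fun i => hv i ▸ hV i) hN p
  have hdeg : ∀ (h : MvPolynomial (Fin n) ℝ), ∀ α ∈ h.support, ∀ i, α i ≤ h.totalDegree + 1 := by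
    intro h α hα i
    have h1 := le_totalDegree hα
    have h2 : α i ≤ α.sum fun _ e => e := by
      rw [Finsupp.sum_fintype _ _ (fun _ => rfl)]
      exact Finset.single_le_sum (f := fun i => α i) (fun _ _ => Nat.zero_le _) (Finset.mem_univ i)
    omega
  have hbt : ∀ h : MvPolynomial (Fin n) ℝ,
      IsSelfAdjoint (boundedTransform u v (h.totalDegree + 1) h) :=
    fun h => isSelfAdjoint_boundedTransform husa hvsa _ h
  have hgnn : ∀ j, 0 ≤ φ (boundedTransform u v ((g j).totalDegree + 1) (g j)) := by
    intro j
    rw [ContinuousLinearMap.nonneg_iff_isPositive, ContinuousLinearMap.isPositive_def']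
    refine ⟨(hbt (g j)).map φ, fun x => ?_⟩
    have hD := hι.dense_prod (fun _ => (g j).totalDegree + 1) Finset.univ
    refine hD.induction_on x (isClosed_le (by fun_prop)
      (ContinuousLinearMap.reApplyInnerSelf_continuous _)) fun p => ?_
    rw [ContinuousLinearMap.reApplyInnerSelf_apply, inner_re_symm, hinner (hdeg _)]
    exact hg j p
  have hfnn : 0 ≤ φ (boundedTransform u v (f.totalDegree + 1) f) := by
    rw [nonneg_iff_forall_characterSpace φ hφs (hbt f)]
    intro χ
    have hreal : ∀ {b : B}, IsSelfAdjoint b → χ b = ((χ b).re : ℂ) := fun hb =>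
      (Complex.conj_eq_iff_re.mp (hb.map χ).star_eq).symm
    set a : Fin n → ℝ := fun i => (χ (u i)).re
    set b : Fin n → ℝ := fun i => (χ (v i)).re
    have ha : ∀ i, χ (u i) = a i := fun i => hreal (husa i)
    have hb : ∀ i, χ (v i) = b i := fun i => hreal (hvsa i)
    rw [re_map_boundedTransform χ ha hb]
    by_cases h0 : ∃ i, b i = 0
    · obtain ⟨i, hi⟩ := h0
      rw [Finset.prod_eq_zero (Finset.mem_univ i) (by rw [hi, zero_pow (Nat.succ_ne_zero _)]),
        zero_mul]
    · push Not at h0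
      rw [boundedTransform_real_eq h0 (hdeg f)]
      refine mul_nonneg (sq_nonneg _) (hf _ fun j => ?_)
      have h1 := (nonneg_iff_forall_characterSpace φ hφs (hbt (g j))).mp (hgnn j) χ
      rw [re_map_boundedTransform χ ha hb, boundedTransform_real_eq h0 (hdeg (g j))] at h1
      refine nonneg_of_mul_nonneg_right h1 (pow_pos (Finset.prod_pos fun i _ => pow_pos ?_ _) 2)
      have h2 := congrArg χ (hrel i)
      rw [map_add, map_mul, map_mul, ha, hb] at h2
      have h3 : a i * a i + b i * b i = b i := by exact_mod_cast h2
      nlinarith [mul_self_nonneg (a i), mul_self_pos.mpr (h0 i)]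
  rw [ContinuousLinearMap.nonneg_iff_isPositive, ContinuousLinearMap.isPositive_def'] at hfnn
  have := hfnn.2 (ι ((∏ i, (1 + X i ^ 2) ^ (f.totalDegree + 1)) * p))
  rwa [ContinuousLinearMap.reApplyInnerSelf_apply, inner_re_symm, hinner (hdeg f) p] at this

theorem exists_hilbert_of_preInner {V : Type u} [AddCommGroup V] [Module ℂ V]
    (c : PreInnerProductSpace.Core ℂ V) :
    ∃ (E : Type u) (_ : NormedAddCommGroup E) (_ : InnerProductSpace ℂ E) (_ : CompleteSpace E)
      (ι : V →ₗ[ℂ] E), DenseRange ι ∧ ∀ p q, inner ℂ (ι p) (ι q) = c.inner p q := by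
  let : SeminormedAddCommGroup V := InnerProductSpace.Core.toSeminormedAddCommGroup (c := c)
  let : InnerProductSpace ℂ V := InnerProductSpace.ofCore c
  exact ⟨UniformSpace.Completion V, inferInstance, inferInstance, inferInstance,
    (UniformSpace.Completion.toComplₗᵢ (𝕜 := ℂ) (E := V)).toLinearMap,
    UniformSpace.Completion.denseRange_coe, fun p q => UniformSpace.Completion.inner_coe p q⟩

section Complexification

variable {n : ℕ}

/-- The complex-linear extension of a real-linear functional on polynomials. -/
noncomputable def complexify (L : MvPolynomial (Fin n) ℝ →ₗ[ℝ] ℝ) :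
    MvPolynomial (Fin n) ℂ →ₗ[ℂ] ℂ :=
  (basisMonomials (Fin n) ℂ).constr ℂ fun α => (L (monomial α 1) : ℂ)

theorem complexify_monomial (L : MvPolynomial (Fin n) ℝ →ₗ[ℝ] ℝ) (α : Fin n →₀ ℕ) (c : ℂ) :
    complexify L (monomial α c) = c * L (monomial α 1) := by
  have h1 : complexify L (monomial α 1) = L (monomial α 1) := by
    simpa [complexify] using (basisMonomials (Fin n) ℂ).constr_basis ℂ
      (fun α => (L (monomial α 1) : ℂ)) α
  rw [← mul_one c, ← smul_eq_mul, ← smul_monomial, map_smul, h1]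
  simp

theorem complexify_map_ofReal (L : MvPolynomial (Fin n) ℝ →ₗ[ℝ] ℝ) (f : MvPolynomial (Fin n) ℝ) :
    complexify L (map Complex.ofRealHom f) = L f := by
  induction f using MvPolynomial.induction_on' with
  | monomial α c =>
    rw [map_monomial, complexify_monomial]
    conv_rhs => rw [← mul_one c, ← smul_eq_mul, ← smul_monomial, map_smul]
    simp
  | add p q hp hq => simp [hp, hq]

theorem complexify_map_conj (L : MvPolynomial (Fin n) ℝ →ₗ[ℝ] ℝ) (p : MvPolynomial (Fin n) ℂ) :
    complexify L (map (starRingEnd ℂ) p) = starRingEnd ℂ (complexify L p) := by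
  induction p using MvPolynomial.induction_on' with
  | monomial α c => simp [map_monomial, complexify_monomial]
  | add p q hp hq => simp [hp, hq]

theorem map_conj_map_ofReal (f : MvPolynomial (Fin n) ℝ) :
    map (starRingEnd ℂ) (map Complex.ofRealHom f) = map Complex.ofRealHom f := by
  rw [map_map]
  congr 2
  ext r
  simp

theorem map_conj_map_conj (p : MvPolynomial (Fin n) ℂ) :
    map (starRingEnd ℂ) (map (starRingEnd ℂ) p) = p := by
  ext α
  simp [coeff_map]

theorem exists_eq_map_add_C_I_mul_map (P : MvPolynomial (Fin n) ℂ) :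
    ∃ p q : MvPolynomial (Fin n) ℝ,
      P = map Complex.ofRealHom p + C Complex.I * map Complex.ofRealHom q := by
  induction P using MvPolynomial.induction_on' with
  | monomial α c =>
    refine ⟨monomial α c.re, monomial α c.im, ?_⟩
    rw [map_monomial, map_monomial, C_mul_monomial, ← map_add]
    congr 1
    rw [mul_comm]
    exact (Complex.re_add_im c).symm
  | add P Q hP hQ =>
    obtain ⟨p, q, rfl⟩ := hP
    obtain ⟨p', q', rfl⟩ := hQ
    exact ⟨p + p', q + q', by simp only [map_add]; ring⟩

theorem re_complexify_nonneg {L : MvPolynomial (Fin n) ℝ →ₗ[ℝ] ℝ} {g : MvPolynomial (Fin n) ℝ}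
    (hg : ∀ p, 0 ≤ L (p ^ 2 * g)) (P : MvPolynomial (Fin n) ℂ) :
    0 ≤ (complexify L (map (starRingEnd ℂ) P * (map Complex.ofRealHom g * P))).re := by
  obtain ⟨p, q, rfl⟩ := exists_eq_map_add_C_I_mul_map P
  have hCI : (C Complex.I : MvPolynomial (Fin n) ℂ) * C Complex.I = -1 := by
    rw [← C_mul, Complex.I_mul_I]; simp
  have : map (starRingEnd ℂ) (map Complex.ofRealHom p + C Complex.I * map Complex.ofRealHom q) *
      (map Complex.ofRealHom g * (map Complex.ofRealHom p + C Complex.I * map Complex.ofRealHom q))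
      = map Complex.ofRealHom (p ^ 2 * g + q ^ 2 * g) := by
    rw [map_add, map_mul, map_C, map_conj_map_ofReal, map_conj_map_ofReal, Complex.conj_I, C_neg]
    simp only [map_add, map_mul, map_pow]
    linear_combination (-(map Complex.ofRealHom g * map Complex.ofRealHom q ^ 2)) * hCI
  rw [this, complexify_map_ofReal, Complex.ofReal_re, map_add]
  exact add_nonneg (hg p) (hg q)

/-- The sesquilinear form `(p, q) ↦ L (conj p * q)`. -/
noncomputable abbrev preInnerOfFunctional (L : MvPolynomial (Fin n) ℝ →ₗ[ℝ] ℝ)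
    (hL : ∀ p, 0 ≤ L (p ^ 2)) : PreInnerProductSpace.Core ℂ (MvPolynomial (Fin n) ℂ) where
  inner p q := complexify L (map (starRingEnd ℂ) p * q)
  conj_inner_symm p q := by
    rw [← complexify_map_conj, map_mul, map_conj_map_conj, mul_comm]
  re_inner_nonneg p := by
    simpa using re_complexify_nonneg (g := 1) (fun p => by simpa using hL p) p
  add_left p q r := by rw [map_add, add_mul, map_add]
  smul_left p q c := by
    rw [smul_eq_C_mul, map_mul (map (starRingEnd ℂ)), map_C, mul_assoc, ← smul_eq_C_mul, map_smul,
      smul_eq_mul]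

theorem wt_le (α : Fin n →₀ ℕ) : wt α ≤ ((α.sum fun _ e => e) + 1).factorial :=
  Nat.factorial_le (by omega)

theorem factorial_add_le (a b : ℕ) :
    (a + b).factorial ≤ 2 ^ (a + b) * a.factorial * b.factorial := by
  rw [← Nat.add_choose_mul_factorial_mul_factorial]
  gcongr
  exact Nat.choose_le_two_pow _ _

theorem factorial_two_mul_add_le (k b : ℕ) :
    (2 * k + b).factorial ≤ 2 ^ b * b.factorial * (4 ^ k * k.factorial) ^ 2 := by
  calc (2 * k + b).factorial ≤ 2 ^ (2 * k + b) * (k + k).factorial * b.factorial := by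
        rw [← two_mul]; exact factorial_add_le _ _
    _ ≤ 2 ^ (2 * k + b) * (2 ^ (k + k) * k.factorial * k.factorial) * b.factorial := by
        gcongr; exact factorial_add_le _ _
    _ = 2 ^ b * b.factorial * (4 ^ k * k.factorial) ^ 2 := by
        rw [show 4 ^ k = 2 ^ (k + k) by rw [← two_mul, pow_mul]; rfl]; ring

theorem wnorm_monomial_one (α : Fin n →₀ ℕ) : wnorm (monomial α 1) = wt α := by
  classical
  simp [wnorm, support_monomial]

theorem norm_complexify_mul_X_pow_le {L : MvPolynomial (Fin n) ℝ →ₗ[ℝ] ℝ}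
    (hL : ∀ p, |L p| ≤ wnorm p) (r : MvPolynomial (Fin n) ℂ) (j : Fin n) :
    ∃ C : ℝ, 0 ≤ C ∧
      ∀ k : ℕ, ‖complexify L (r * X j ^ (2 * k))‖ ≤ C * (4 ^ k * k.factorial) ^ 2 := by
  set b : ℕ := r.totalDegree + 1
  refine ⟨(∑ α ∈ r.support, ‖r.coeff α‖) * (2 ^ b * b.factorial), by positivity, fun k => ?_⟩
  have h1 : r * X j ^ (2 * k) =
      ∑ α ∈ r.support, monomial (α + Finsupp.single j (2 * k)) (r.coeff α) := by
    conv_lhs => rw [r.as_sum, Finset.sum_mul]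
    refine Finset.sum_congr rfl fun α _ => ?_
    rw [X_pow_eq_monomial, monomial_mul, mul_one]
  rw [h1, map_sum, mul_assoc, Finset.sum_mul]
  refine norm_sum_le_of_le _ fun α hα => ?_
  rw [complexify_monomial, norm_mul, Complex.norm_real, Real.norm_eq_abs]
  gcongr
  refine (hL _).trans ?_
  rw [wnorm_monomial_one]
  have h2 : wt (α + Finsupp.single j (2 * k)) ≤ (2 * k + b).factorial := by
    refine (wt_le _).trans (Nat.factorial_le ?_)
    rw [Finsupp.sum_add_index' (fun _ => rfl) (fun _ _ _ => rfl), Finsupp.sum_single_index rfl]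
    have := le_totalDegree hα
    omega
  exact_mod_cast h2.trans (factorial_two_mul_add_le k b)

end Complexification

theorem exists_isAnalyticRep {n : ℕ} {L : MvPolynomial (Fin n) ℝ →ₗ[ℝ] ℝ}
    (hL : ∀ p, 0 ≤ L (p ^ 2)) (hLw : ∀ p, |L p| ≤ wnorm p) :
    ∃ (E : Type) (_ : NormedAddCommGroup E) (_ : InnerProductSpace ℂ E) (_ : CompleteSpace E)
      (ι : MvPolynomial (Fin n) ℂ →ₗ[ℂ] E), IsAnalyticRep ι ∧
        ∀ p q, inner ℂ (ι p) (ι q) = complexify L (map (starRingEnd ℂ) p * q) := by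
  obtain ⟨E, _, _, _, ι, hd, hι⟩ := exists_hilbert_of_preInner (preInnerOfFunctional L hL)
  replace hι : ∀ p q, inner ℂ (ι p) (ι q) = complexify L (map (starRingEnd ℂ) p * q) := hι
  refine ⟨E, _, _, ‹_›, ι, ⟨hd, fun f p q => ?_, fun j p => ?_⟩, hι⟩
  · rw [hι, hι, map_mul (map (starRingEnd ℂ)), map_conj_map_ofReal, mul_left_comm, mul_assoc,
      mul_left_comm]
  · obtain ⟨C, hC0, hC⟩ := norm_complexify_mul_X_pow_le hLw (map (starRingEnd ℂ) p * p) j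
    refine ⟨√C, fun k => ?_⟩
    have h1 : ‖ι (X j ^ k * p)‖ ^ 2 ≤ C * (4 ^ k * k.factorial) ^ 2 := by
      have h2 := hC k
      rw [show map (starRingEnd ℂ) p * p * X j ^ (2 * k) =
        map (starRingEnd ℂ) (X j ^ k * p) * (X j ^ k * p) by
          rw [map_mul, map_pow, map_X]; ring, ← hι, inner_self_eq_norm_sq_to_K] at h2
      simpa using h2
    rw [mul_assoc]
    refine le_of_sq_le_sq ?_ (by positivity)
    rwa [mul_pow, Real.sq_sqrt hC0]

theorem exists_nonneg_on_cone {V : Type*} [AddCommGroup V] [Module ℝ V] (s : Seminorm ℝ V)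
    (Q : PointedCone ℝ V) {f : V} {ε : ℝ} (hε : 0 < ε) (hf : ∀ h ∈ Q, ε ≤ s (f - h)) :
    ∃ L : V →ₗ[ℝ] ℝ, (∀ h ∈ Q, 0 ≤ L h) ∧ L f < 0 ∧ ∀ p, |L p| ≤ s p := by
  let N : V → ℝ := fun p => ⨅ h : Q, s (p + h)
  have hbdd : ∀ p, BddBelow (Set.range fun h : Q => s (p + h)) := fun p =>
    ⟨0, by rintro _ ⟨h, rfl⟩; exact apply_nonneg s _⟩
  have hNle : ∀ p, ∀ h ∈ Q, N p ≤ s (p + h) := fun p h hh => ciInf_le (hbdd p) ⟨h, hh⟩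
  have hN0 : ∀ p, 0 ≤ N p := fun p => le_ciInf fun h => apply_nonneg s _
  have hNs : ∀ p, N p ≤ s p := fun p => by simpa using hNle p 0 Q.zero_mem
  have hNsmul_le : ∀ c : ℝ, 0 < c → ∀ p, N (c • p) ≤ c * N p := by
    intro c hc p
    rw [← div_le_iff₀' hc]
    refine le_ciInf fun h => ?_
    rw [div_le_iff₀' hc]
    refine (hNle _ _ (Q.smul_mem hc.le h.2)).trans (le_of_eq ?_)
    rw [← smul_add, map_smul_eq_mul, Real.norm_of_nonneg hc.le]
  have hNsmul : ∀ c : ℝ, 0 < c → ∀ p, N (c • p) = c * N p := by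
    intro c hc p
    refine le_antisymm (hNsmul_le c hc p) ?_
    have := hNsmul_le c⁻¹ (inv_pos.mpr hc) (c • p)
    rwa [inv_smul_smul₀ hc.ne', ← div_eq_inv_mul, le_div_iff₀' hc] at this
  have hNadd : ∀ p q, N (p + q) ≤ N p + N q := by
    intro p q
    refine le_ciInf_add_ciInf fun h h' => ?_
    refine (hNle _ _ (Q.add_mem h.2 h'.2)).trans ?_
    rw [add_add_add_comm]
    exact map_add_le_add s _ _
  have hNf : ε ≤ N (-f) := le_ciInf fun h => by
    rw [neg_add_eq_sub, map_sub_rev]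
    exact hf h h.2
  have hf0 : -f ≠ 0 := by
    rintro h
    have := hf 0 Q.zero_mem
    rw [sub_zero, neg_eq_zero.mp h, map_zero] at this
    exact this.not_gt hε
  obtain ⟨L, hL, hLN⟩ := exists_extension_of_le_sublinear
    (LinearPMap.mkSpanSingleton (-f) ε hf0) N hNsmul hNadd (by
      rintro ⟨x, hx⟩
      obtain ⟨c, rfl⟩ := Submodule.mem_span_singleton.mp hx
      refine (LinearPMap.mkSpanSingleton'_apply (-f) ε _ c hx).trans_le ?_
      rw [RingHom.id_apply, smul_eq_mul]
      rcases lt_or_ge 0 c with hc | hc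
      · rw [hNsmul c hc]
        gcongr
      · exact (mul_nonpos_of_nonpos_of_nonneg hc hε.le).trans (hN0 _))
  have hLf : L (-f) = ε := by
    rw [hL ⟨-f, Submodule.mem_span_singleton_self _⟩]
    exact LinearPMap.mkSpanSingleton_apply ℝ ℝ hf0 ε
  refine ⟨L, fun h hh => ?_, ?_, fun p => abs_le.mpr ⟨?_, (hLN p).trans (hNs p)⟩⟩
  · have := (hLN (-h)).trans (hNle _ h hh)
    rw [neg_add_cancel, map_zero, map_neg] at this
    linarith
  · rw [map_neg] at hLf
    linarith
  · have := (hLN (-p)).trans (hNs _)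
    rw [map_neg, map_neg_eq_map] at this
    linarith

section QuadraticModule

variable {n m : ℕ}

theorem wnorm_eq_sum {f : MvPolynomial (Fin n) ℝ} {S : Finset (Fin n →₀ ℕ)} (hS : f.support ⊆ S) :
    wnorm f = ∑ α ∈ S, (wt α : ℝ) * |f.coeff α| :=
  Finset.sum_subset hS fun α _ hα => by rw [notMem_support_iff.mp hα, abs_zero, mul_zero]

/-- The weighted ℓ₁-norm as a seminorm. -/
noncomputable def wnormSeminorm (n : ℕ) : Seminorm ℝ (MvPolynomial (Fin n) ℝ) :=
  Seminorm.of wnorm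
    (fun p q => by
      classical
      rw [wnorm_eq_sum support_add, wnorm_eq_sum (Finset.subset_union_left (s₂ := q.support)),
        wnorm_eq_sum (f := q) (Finset.subset_union_right (s₁ := p.support)),
        ← Finset.sum_add_distrib]
      refine Finset.sum_le_sum fun α _ => ?_
      rw [← mul_add, coeff_add]
      gcongr
      exact abs_add_le _ _)
    (fun c p => by
      rw [wnorm_eq_sum support_smul, wnorm, Finset.mul_sum]
      refine Finset.sum_congr rfl fun α _ => ?_
      rw [coeff_smul, smul_eq_mul, abs_mul, Real.norm_eq_abs, mul_left_comm])

theorem IsSOS.zero : IsSOS (0 : MvPolynomial (Fin n) ℝ) := ⟨0, Fin.elim0, by simp⟩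

theorem IsSOS.sq (p : MvPolynomial (Fin n) ℝ) : IsSOS (p ^ 2) := ⟨1, fun _ => p, by simp⟩

theorem IsSOS.add {σ τ : MvPolynomial (Fin n) ℝ} (hσ : IsSOS σ) (hτ : IsSOS τ) :
    IsSOS (σ + τ) := by
  obtain ⟨k, p, rfl⟩ := hσ
  obtain ⟨l, q, rfl⟩ := hτ
  exact ⟨k + l, Fin.append p q, by simp [Fin.sum_univ_add]⟩

theorem IsSOS.smul {σ : MvPolynomial (Fin n) ℝ} (hσ : IsSOS σ) {c : ℝ} (hc : 0 ≤ c) :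
    IsSOS (c • σ) := by
  obtain ⟨k, p, rfl⟩ := hσ
  refine ⟨k, fun i => √c • p i, ?_⟩
  simp only [smul_pow, Real.sq_sqrt hc, Finset.smul_sum]

theorem IsSOS.eval_nonneg {σ : MvPolynomial (Fin n) ℝ} (hσ : IsSOS σ) (x : Fin n → ℝ) :
    0 ≤ eval x σ := by
  obtain ⟨k, p, rfl⟩ := hσ
  simp only [map_sum, map_pow]
  positivity

/-- The quadratic module generated by `g`, as a convex cone. -/
def quadraticModule (g : Fin m → MvPolynomial (Fin n) ℝ) :
    PointedCone ℝ (MvPolynomial (Fin n) ℝ) where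
  carrier := {f | memQM g f}
  zero_mem' := ⟨0, fun _ => 0, IsSOS.zero, fun _ => IsSOS.zero, by simp⟩
  add_mem' := by
    rintro _ _ ⟨σ₀, σ, h₀, h, rfl⟩ ⟨τ₀, τ, h₀', h', rfl⟩
    refine ⟨σ₀ + τ₀, fun j => σ j + τ j, h₀.add h₀', fun j => (h j).add (h' j), ?_⟩
    simp only [add_mul, Finset.sum_add_distrib]
    ring
  smul_mem' := by
    rintro c _ ⟨σ₀, σ, h₀, h, rfl⟩
    refine ⟨(c : ℝ) • σ₀, fun j => (c : ℝ) • σ j, h₀.smul c.2, fun j => (h j).smul c.2, ?_⟩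
    change (c : ℝ) • (σ₀ + ∑ j, σ j * g j) = _
    simp only [smul_add, Finset.smul_sum, smul_mul_assoc]

theorem memQM_sq (g : Fin m → MvPolynomial (Fin n) ℝ) (p : MvPolynomial (Fin n) ℝ) :
    memQM g (p ^ 2) :=
  ⟨p ^ 2, fun _ => 0, IsSOS.sq p, fun _ => IsSOS.zero, by simp⟩

theorem memQM_sq_mul (g : Fin m → MvPolynomial (Fin n) ℝ) (j : Fin m)
    (p : MvPolynomial (Fin n) ℝ) : memQM g (p ^ 2 * g j) := by
  classical
  refine ⟨0, Pi.single j (p ^ 2), IsSOS.zero, fun i => ?_, ?_⟩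
  · rcases eq_or_ne i j with rfl | h
    · rw [Pi.single_eq_same]
      exact IsSOS.sq p
    · rw [Pi.single_eq_of_ne h]
      exact IsSOS.zero
  · rw [Finset.sum_eq_single j (fun i _ h => by rw [Pi.single_eq_of_ne h, zero_mul]) (by simp),
      Pi.single_eq_same, zero_add]

theorem memQM.eval_nonneg {g : Fin m → MvPolynomial (Fin n) ℝ} {f : MvPolynomial (Fin n) ℝ}
    (hf : memQM g f) {x : Fin n → ℝ} (hx : ∀ j, 0 ≤ eval x (g j)) : 0 ≤ eval x f := by
  obtain ⟨σ₀, σ, h₀, h, rfl⟩ := hf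
  simp only [map_add, map_sum, map_mul]
  exact add_nonneg (h₀.eval_nonneg x)
    (Finset.sum_nonneg fun j _ => mul_nonneg ((h j).eval_nonneg x) (hx j))

theorem factorial_degree_le_wt (α : Fin n →₀ ℕ) : (α.sum fun _ e => e).factorial ≤ wt α :=
  Nat.factorial_le (by omega)

theorem abs_eval_le (x : Fin n → ℝ) (p : MvPolynomial (Fin n) ℝ) :
    |eval x p| ≤ Real.exp (∑ i, |x i|) * wnorm p := by
  set R := ∑ i, |x i|
  rw [eval_eq', wnorm, Finset.mul_sum]
  refine (Finset.abs_sum_le_sum_abs _ _).trans (Finset.sum_le_sum fun α _ => ?_)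
  rw [abs_mul, Finset.abs_prod, ← mul_assoc, mul_comm]
  gcongr
  calc ∏ i, |x i ^ α i| ≤ ∏ i, R ^ α i := by
        refine Finset.prod_le_prod (fun _ _ => abs_nonneg _) fun i _ => ?_
        rw [abs_pow]
        gcongr
        exact Finset.single_le_sum (f := fun i => |x i|) (fun _ _ => abs_nonneg _)
          (Finset.mem_univ i)
    _ = R ^ (α.sum fun _ e => e) := by
        rw [Finset.prod_pow_eq_pow_sum, Finsupp.sum_fintype _ _ (fun _ => rfl)]
    _ ≤ Real.exp R * (α.sum fun _ e => e).factorial := by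
        rw [← div_le_iff₀ (by positivity)]
        exact Real.pow_div_factorial_le_exp _ (by positivity) _
    _ ≤ Real.exp R * wt α := by
        gcongr
        exact factorial_degree_le_wt α

end QuadraticModule

theorem stmt4 {n m : ℕ} (g : Fin m → MvPolynomial (Fin n) ℝ)
    (K : Set (Fin n → ℝ)) (hK : K = {x | ∀ j, 0 ≤ eval x (g j)}) :
    {f : MvPolynomial (Fin n) ℝ |
        ∀ ε : ℝ, 0 < ε → ∃ h, memQM g h ∧ wnorm (f - h) < ε} =
      {f : MvPolynomial (Fin n) ℝ | ∀ x ∈ K, 0 ≤ eval x f} := by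
  subst hK
  ext f
  constructor
  · intro hf x hx
    by_contra! hneg
    obtain ⟨h, hh, hlt⟩ := hf (-eval x f * (Real.exp (∑ i, |x i|))⁻¹)
      (mul_pos (neg_pos.mpr hneg) (inv_pos.mpr (Real.exp_pos _)))
    rw [← div_eq_mul_inv, lt_div_iff₀' (Real.exp_pos _)] at hlt
    have h2 := (abs_eval_le x (f - h)).trans_lt hlt
    have h3 := hh.eval_nonneg hx
    rw [map_sub, abs_lt] at h2
    linarith [h2.1]
  · intro hf
    by_contra hcl
    rw [Set.mem_ofPred_eq] at hcl
    push Not at hcl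
    obtain ⟨ε, hε, hcl⟩ := hcl
    obtain ⟨L, hLQ, hLf, hLw⟩ :=
      exists_nonneg_on_cone (wnormSeminorm n) (quadraticModule g) hε hcl
    obtain ⟨E, _, _, _, ι, hι, hin⟩ :=
      exists_isAnalyticRep (fun p => hLQ _ (memQM_sq g p)) hLw
    have := hι.inner_mul_nonneg g (fun j p => by
      rw [hin]
      exact re_complexify_nonneg (fun p => hLQ _ (memQM_sq_mul g j p)) p) hf 1
    rw [hin, map_one, one_mul, mul_one, complexify_map_ofReal, Complex.ofReal_re] at this
    exact this.not_gt hLf
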